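/- Let p be an odd prime and r a positive integer. There exists a non-abelian UCS p-group G of exponent p² with |G/Φ(G)| = p^r (and then necessarily |G| = p^{2r}) if and only if there exists an irreducible subgroup K ≤ GL_r(F_p) and an F_pK-submodule U of the exterior square Λ²(F_p^r) such that the quotient module Λ²(F_p^r)/U is isomorphic to the natural F_pK-module F_p^r. -/

import Mathlib

open TensorProduct

section ExteriorSquare

variable (F : Type*) [Field F] (V : Type*) [AddCommGroup V] [Module F V]

/-- The submodule of `V ⊗ V` spanned by the squares `v ⊗ v`. -/
def sqSub : Submodule F (V ⊗[F] V) :=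
  Submodule.span F {x : V ⊗[F] V | ∃ v : V, x = v ⊗ₜ[F] v}

/-- The exterior square `Λ²V`, realised as `V ⊗ V` modulo the squares. -/
abbrev Wedge2 := (V ⊗[F] V) ⧸ sqSub F V

variable {F V}

/-- The map `Λ²g = g ∧ g` induced on the exterior square by `g : V → V`. -/
noncomputable def wedge2Map (g : V →ₗ[F] V) : Wedge2 F V →ₗ[F] Wedge2 F V :=
  Submodule.mapQ _ _ (TensorProduct.map g g) (by
    rw [← Submodule.map_le_iff_le_comap, sqSub, Submodule.map_span]
    refine Submodule.span_le.2 ?_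
    rintro _ ⟨_, ⟨v, rfl⟩, rfl⟩
    exact Submodule.subset_span ⟨g v, by simp⟩)

end ExteriorSquare

section LinearGroups

variable {n : ℕ} {F : Type*} [Field F]

/-- The natural action of `g ∈ GL_n(F)` on row vectors. -/
def natAct (g : GL (Fin n) F) : (Fin n → F) →ₗ[F] (Fin n → F) :=
  Matrix.vecMulLinear (g : Matrix (Fin n) (Fin n) F)

/-- `G ≤ GL_n(F)` acts irreducibly on the natural module `F^n`. -/
def IsIrred (G : Subgroup (GL (Fin n) F)) : Prop :=
  ∀ S : Submodule F (Fin n → F),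
    (∀ g ∈ G, Submodule.map (natAct g) S = S) → S = ⊥ ∨ S = ⊤

/-- The natural module `F^n` is an exterior self-quotient (ESQ) module for
`G ≤ GL_n(F)`: there is a `G`-invariant submodule `U ≤ Λ²(F^n)` and a
`G`-equivariant isomorphism `Λ²(F^n)/U ≃ F^n`. -/
def IsESQ (G : Subgroup (GL (Fin n) F)) : Prop :=
  ∃ (U : Submodule F (Wedge2 F (Fin n → F)))
    (e : ((Wedge2 F (Fin n → F)) ⧸ U) ≃ₗ[F] (Fin n → F)),
    (∀ g ∈ G, Submodule.map (wedge2Map (natAct g)) U ≤ U) ∧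
    ∀ g ∈ G, ∀ w : Wedge2 F (Fin n → F),
      e (Submodule.Quotient.mk (wedge2Map (natAct g) w)) =
        natAct g (e (Submodule.Quotient.mk w))

/-- `G ≤ GL_n(F)` is absolutely irreducible: it remains irreducible over the
algebraic closure of `F`. -/
def IsAbsIrred (G : Subgroup (GL (Fin n) F)) : Prop :=
  ∀ S : Submodule (AlgebraicClosure F) (Fin n → AlgebraicClosure F),
    (∀ g ∈ G, Submodule.map
        (Matrix.vecMulLinear
          ((g : Matrix (Fin n) (Fin n) F).map (algebraMap F (AlgebraicClosure F)))) S = S) →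
      S = ⊥ ∨ S = ⊤

/-- `G` is a minimal irreducible ESQ-subgroup of `GL_n(F)`: it is irreducible,
the natural module is ESQ for `G`, and every proper subgroup acts reducibly. -/
def IsMinIrredESQ (G : Subgroup (GL (Fin n) F)) : Prop :=
  IsIrred G ∧ IsESQ G ∧
    ∀ H : Subgroup (GL (Fin n) F), H < G → ¬ IsIrred H

end LinearGroups

/-- A finite `p`-group is a UCS group if it has exactly three characteristic
subgroups. -/
def IsUCS (p : ℕ) (G : Type*) [Group G] : Prop :=
  IsPGroup p G ∧ Nat.card {H : Subgroup G // H.Characteristic} = 3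

section UCSCriteria

/-- If `N` is central of exponent dividing `p` and consists of `p`-th powers, then `N` consists of
non-generators. -/
theorem eq_top_of_sup_eq_top_of_pow {G : Type*} [Group G] {p : ℕ} {H N : Subgroup G}
    (hN : N ≤ Subgroup.center G) (hp : ∀ z ∈ N, z ^ p = 1) (hpow : ∀ z ∈ N, ∃ x, x ^ p = z)
    (h : H ⊔ N = ⊤) : H = ⊤ := by
  have : N.Normal := ⟨fun n hn g => by
    rwa [Subgroup.mem_center_iff.1 (hN hn) g, mul_inv_cancel_right]⟩
  have hNH : N ≤ H := by
    intro z hz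
    obtain ⟨x, rfl⟩ := hpow z hz
    obtain ⟨a, ha, b, hb, rfl⟩ :=
      Subgroup.mem_sup_of_normal_right.1 (h ▸ Subgroup.mem_top x : x ∈ H ⊔ N)
    have hc : Commute a b := Subgroup.mem_center_iff.1 (hN hb) a
    rw [hc.mul_pow, hp b hb, mul_one]
    exact H.pow_mem ha p
  rwa [sup_eq_left.2 hNH] at h

theorem le_frattini_of_pow {G : Type*} [Group G] {p : ℕ} {N : Subgroup G}
    (hN : N ≤ Subgroup.center G) (hp : ∀ z ∈ N, z ^ p = 1) (hpow : ∀ z ∈ N, ∃ x, x ^ p = z) :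
    N ≤ frattini G := by
  refine le_iInf₂ fun M hM => ?_
  by_contra hNM
  refine hM.1 (eq_top_of_sup_eq_top_of_pow hN hp hpow (hM.2 _ ?_))
  exact lt_of_le_of_ne le_sup_left fun h => hNM (h ▸ le_sup_right)

theorem frattini_ne_top {G : Type*} [Group G] [IsCoatomic (Subgroup G)] [Nontrivial G] :
    frattini G ≠ ⊤ := fun h =>
  bot_ne_top (frattini_nongenerating (G := G) (K := ⊥) (by rw [h, sup_top_eq]))

/-- A group with exactly three characteristic subgroups has no others than `⊥`, `⊤` and any given
proper nontrivial one. -/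
theorem characteristic_trichotomy {G : Type*} [Group G] {N : Subgroup G}
    (h : Nat.card {H : Subgroup G // H.Characteristic} = 3) (hN : N.Characteristic)
    (hbot : N ≠ ⊥) (htop : N ≠ ⊤) (H : Subgroup G) (hH : H.Characteristic) :
    H = ⊥ ∨ H = N ∨ H = ⊤ := by
  have h' : Set.ncard {H : Subgroup G | H.Characteristic} = 3 := h
  have hlt : (⊥ : Subgroup G) ≠ ⊤ := fun e => hbot (le_bot_iff.1 (e ▸ le_top))
  have hs : ({⊥, N, ⊤} : Set (Subgroup G)) = {H : Subgroup G | H.Characteristic} := by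
    refine Set.eq_of_subset_of_ncard_le ?_ ?_ (Set.finite_of_ncard_ne_zero (by omega))
    · rintro K (rfl | rfl | rfl)
      · exact Subgroup.botCharacteristic
      · exact hN
      · exact Subgroup.topCharacteristic
    · rw [h', (Set.ncard_eq_three).2 ⟨⊥, N, ⊤, hbot.symm, hlt, htop, rfl⟩]
  have : H ∈ ({⊥, N, ⊤} : Set (Subgroup G)) := hs ▸ hH
  simpa using this

theorem card_characteristic_eq_three {G : Type*} [Group G] {N : Subgroup G}
    (hN : N.Characteristic) (hbot : N ≠ ⊥) (htop : N ≠ ⊤)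
    (h : ∀ H : Subgroup G, H.Characteristic → H = ⊥ ∨ H = N ∨ H = ⊤) :
    Nat.card {H : Subgroup G // H.Characteristic} = 3 := by
  have hlt : (⊥ : Subgroup G) ≠ ⊤ := fun e => hbot (le_bot_iff.1 (e ▸ le_top))
  have hs : {H : Subgroup G | H.Characteristic} = {⊥, N, ⊤} := by
    ext K
    refine ⟨fun hK => by simpa using h K hK, ?_⟩
    rintro (rfl | rfl | rfl)
    · exact Subgroup.botCharacteristic
    · exact hN
    · exact Subgroup.topCharacteristic
  exact (Set.ncard_eq_three).2 ⟨⊥, N, ⊤, hbot.symm, hlt, htop, hs⟩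

end UCSCriteria

section Twist

variable {M V : Type*} [AddCommGroup M] [AddCommGroup V]

/-- The group law `x * y = x + y + j (B (red x) (red y))` on an abelian group `M`, for a
biadditive alternating map `B` on a quotient `red : M → V` and a map `j : V → M` with
`red ∘ j = 0`. -/
@[reducible] def twistGroup (red : M →+ V) (j : V →+ M) (B : V →+ V →+ V)
    (hrj : ∀ v, red (j v) = 0) (halt : ∀ v, B v v = 0) : Group M where
  mul x y := x + y + j (B (red x) (red y))
  one := 0
  inv x := -x
  mul_assoc x y z := by
    change (x + y + j (B (red x) (red y))) + z + j (B (red (x + y + j (B (red x) (red y)))) (red z))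
      = x + (y + z + j (B (red y) (red z))) + j (B (red x) (red (y + z + j (B (red y) (red z)))))
    simp only [map_add, hrj, add_zero, AddMonoidHom.add_apply]
    abel
  one_mul x := by
    change 0 + x + j (B (red 0) (red x)) = x
    simp
  mul_one x := by
    change x + 0 + j (B (red x) (red 0)) = x
    simp
  inv_mul_cancel x := by
    change -x + x + j (B (red (-x)) (red x)) = 0
    simp [halt]

theorem exists_ucs_of_alternating {p : ℕ} [Fact p.Prime] (hodd : Odd p) [Finite M]
    (red : M →+ V) (j : V →+ M) (B : V →+ V →+ V)
    (hred : Function.Surjective red) (hj : Function.Injective j)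
    (hjr : ∀ x, j (red x) = p • x) (hker : ∀ x, red x = 0 → ∃ v, j v = x)
    (hV : ∀ v : V, p • v = 0)
    (halt : ∀ v, B v v = 0) (hB : ∃ u v, B u v ≠ 0)
    (hirr : ∀ S : AddSubgroup V, (∀ (φ : M →+ M) (k : V ≃+ V), (∀ x, red (φ x) = k (red x)) →
      (∀ u v, B (k u) (k v) = k (B u v)) → ∀ v ∈ S, k v ∈ S) → S = ⊥ ∨ S = ⊤) :
    ∃ _ : Group M, IsUCS p M ∧ (¬ ∀ a b : M, a * b = b * a) ∧ Monoid.exponent M = p ^ 2 ∧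
      Nat.card (M ⧸ frattini M) = Nat.card V := by
  have hrj : ∀ v, red (j v) = 0 := by
    intro v
    obtain ⟨x, rfl⟩ := hred v
    rw [hjr, map_nsmul, hV]
  have hpr : p.Prime := Fact.out
  let inst : Group M := twistGroup red j B hrj halt
  have hmul : ∀ x y : M, x * y = x + y + j (B (red x) (red y)) := fun _ _ => rfl
  have hone : (1 : M) = 0 := rfl
  have hinv : ∀ x : M, x⁻¹ = -x := fun _ => rfl
  have hpow : ∀ (x : M) (n : ℕ), x ^ n = n • x := by
    intro x n
    induction n with
    | zero => simp [hone]
    | succ n ih => rw [pow_succ, ih, hmul, map_nsmul, map_nsmul, AddMonoidHom.nsmul_apply, halt,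
        smul_zero, map_zero, add_zero, succ_nsmul]
  have hpp : ∀ x : M, x ^ (p ^ 2) = 1 := by
    intro x
    rw [hpow, pow_two, mul_nsmul, ← hjr, map_nsmul, hV, map_zero, hone]
  obtain ⟨u₀, v₀, huv⟩ := hB
  have hu₀ : u₀ ≠ 0 := by rintro rfl; simp at huv
  obtain ⟨a₀, ha₀⟩ := hred u₀
  obtain ⟨b₀, hb₀⟩ := hred v₀
  have hanti : ∀ u v, B u v = - B v u := by
    intro u v
    have := halt (u + v)
    simp only [map_add, AddMonoidHom.add_apply, halt, zero_add, add_zero] at this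
    rw [eq_neg_iff_add_eq_zero, add_comm, this]
  -- the reduction map as a homomorphism from the twisted group, and its kernel
  let R : M →* Multiplicative V :=
    { toFun := fun x => Multiplicative.ofAdd (red x)
      map_one' := by rw [hone, map_zero]; rfl
      map_mul' := fun x y => by
        rw [hmul, map_add red, map_add red, hrj, add_zero, ofAdd_add] }
  have hRsurj : Function.Surjective R := fun v => hred v
  have hkerR : ∀ x, x ∈ R.ker ↔ red x = 0 := fun x => Iff.rfl
  have hkerpow : ∀ x : M, x ∈ R.ker ↔ x ^ p = 1 := by
    intro x
    rw [hkerR, hpow, ← hjr, hone, map_eq_zero_iff j hj]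
  have hchar : R.ker.Characteristic := by
    refine Subgroup.characteristic_iff_le_comap.2 fun φ x hx => ?_
    rw [Subgroup.mem_comap, hkerpow, ← map_pow, (hkerpow x).1 hx, map_one]
  have hcent : R.ker ≤ Subgroup.center M := by
    intro x hx
    rw [Subgroup.mem_center_iff]
    intro y
    rw [hmul, hmul, (hkerR x).1 hx]
    simp [add_comm]
  have hpth : ∀ z ∈ R.ker, ∃ x : M, x ^ p = z := by
    intro z hz
    obtain ⟨v, rfl⟩ := hker z hz
    obtain ⟨x, rfl⟩ := hred v
    exact ⟨x, by rw [hpow, hjr]⟩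
  have hkertop : R.ker ≠ ⊤ := by
    intro h
    have : a₀ ∈ R.ker := h ▸ Subgroup.mem_top a₀
    rw [hkerR, ha₀] at this
    exact hu₀ this
  have hkerbot : R.ker ≠ ⊥ := by
    intro h
    have : j u₀ ∈ R.ker := hrj u₀
    rw [h, Subgroup.mem_bot, hone, map_eq_zero_iff j hj] at this
    exact hu₀ this
  have : Nontrivial M := ⟨a₀, 0, by rintro rfl; rw [map_zero] at ha₀; exact hu₀ ha₀.symm⟩
  have hlift : ∀ (φ : M →+ M) (k : V ≃+ V), (∀ x, red (φ x) = k (red x)) →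
      (∀ u v, B (k u) (k v) = k (B u v)) →
      (∀ v, φ (j v) = j (k v)) ∧ ∃ α : M ≃* M, ∀ x, α x = φ x := by
    intro φ k hφ hk
    have hφj : ∀ v, φ (j v) = j (k v) := by
      intro v
      obtain ⟨x, rfl⟩ := hred v
      rw [hjr, map_nsmul, ← hjr, hφ]
    refine ⟨hφj, ?_⟩
    let α : M →* M :=
      { toFun := φ
        map_one' := by rw [hone, map_zero]
        map_mul' := fun x y => by simp only [hmul, map_add, hφj, hφ, hk] }
    have hα : Function.Injective α := by
      rw [injective_iff_map_eq_one]
      intro x (hx : φ x = 0)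
      have h1 : red x = 0 := by
        rw [← map_eq_zero_iff k k.injective, ← hφ, hx, map_zero]
      obtain ⟨v, rfl⟩ := hker x h1
      rw [hφj, map_eq_zero_iff j hj, map_eq_zero_iff k k.injective] at hx
      rw [hx, map_zero, hone]
    exact ⟨MulEquiv.ofBijective α (Finite.injective_iff_bijective.1 hα), fun _ => rfl⟩
  have htri : ∀ H : Subgroup M, H.Characteristic → H = ⊥ ∨ H = R.ker ∨ H = ⊤ := by
    intro H hH
    have hH' := Subgroup.characteristic_iff_le_comap.1 hH
    rcases hirr (Subgroup.toAddSubgroup' (H.map R)) (by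
      rintro φ k hφ hk v ⟨x, hx, rfl⟩
      obtain ⟨-, α, hα⟩ := hlift φ k hφ hk
      refine ⟨α x, hH' α hx, ?_⟩
      change red (α x) = k (red x)
      rw [hα, hφ]) with h | h
    · have hHle : H ≤ R.ker := by
        intro x hx
        have : red x ∈ Subgroup.toAddSubgroup' (H.map R) := ⟨x, hx, rfl⟩
        rw [h] at this
        exact this
      let S : AddSubgroup V :=
        { carrier := {v | j v ∈ H}
          zero_mem' := by
            change j 0 ∈ H
            rw [map_zero]
            exact H.one_mem
          add_mem' := fun {u v} hu hv => by
            have := H.mul_mem hu hv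
            rw [hmul, hrj, map_zero, AddMonoidHom.zero_apply, map_zero, add_zero] at this
            change j (u + v) ∈ H
            rwa [map_add]
          neg_mem' := fun {u} hu => by
            have := H.inv_mem hu
            rw [hinv] at this
            change j (-u) ∈ H
            rwa [map_neg] }
      rcases hirr S (by
        intro φ k hφ hk v hv
        obtain ⟨hφj, α, hα⟩ := hlift φ k hφ hk
        have : α (j v) ∈ H := hH' α hv
        rw [hα, hφj] at this
        exact this) with hS | hS
      · left
        rw [Subgroup.eq_bot_iff_forall]
        intro x hx
        obtain ⟨v, rfl⟩ := hker x (hHle hx)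
        have : v ∈ S := hx
        rw [hS, AddSubgroup.mem_bot] at this
        rw [this, map_zero, hone]
      · right; left
        refine le_antisymm hHle fun x hx => ?_
        obtain ⟨v, rfl⟩ := hker x hx
        exact (hS ▸ AddSubgroup.mem_top v : v ∈ S)
    · right; right
      refine eq_top_of_sup_eq_top_of_pow hcent (fun z hz => (hkerpow z).1 hz) hpth ?_
      rw [eq_top_iff]
      intro x _
      obtain ⟨y, hy, hyx⟩ : red x ∈ Subgroup.toAddSubgroup' (H.map R) := h ▸ AddSubgroup.mem_top _
      have hyx' : R y = R x := hyx
      rw [← mul_inv_cancel_left y x]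
      refine Subgroup.mul_mem_sup hy ?_
      rw [MonoidHom.mem_ker, map_mul, map_inv, hyx', inv_mul_cancel]
  refine ⟨inst, ⟨fun x => ⟨2, hpp x⟩, card_characteristic_eq_three hchar hkerbot hkertop htri⟩,
    ?_, ?_, ?_⟩
  · intro hcomm
    have h := hcomm a₀ b₀
    rw [hmul, hmul, add_comm b₀ a₀, add_right_inj, ha₀, hb₀, hj.eq_iff, hanti v₀ u₀] at h
    rw [eq_neg_iff_add_eq_zero, ← two_nsmul] at h
    have h2 : addOrderOf (B u₀ v₀) ∣ Nat.gcd 2 p :=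
      Nat.dvd_gcd (addOrderOf_dvd_of_nsmul_eq_zero h) (addOrderOf_dvd_of_nsmul_eq_zero (hV _))
    rw [Nat.coprime_two_left.2 hodd, Nat.dvd_one, AddMonoid.addOrderOf_eq_one_iff] at h2
    exact huv h2
  · have hdvd : Monoid.exponent M ∣ p ^ 2 := Monoid.exponent_dvd_of_forall_pow_eq_one hpp
    obtain ⟨k, hk, hkeq⟩ := (Nat.dvd_prime_pow hpr).1 hdvd
    have : ¬ Monoid.exponent M ∣ p := by
      intro h
      have h1 : a₀ ∈ R.ker := (hkerpow a₀).2 (Monoid.exponent_dvd_iff_forall_pow_eq_one.1 h a₀)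
      rw [hkerR, ha₀] at h1
      exact hu₀ h1
    rw [hkeq] at this ⊢
    interval_cases k
    · simp at this
    · simp at this
    · rfl
  · have hle := le_frattini_of_pow hcent (fun z hz => (hkerpow z).1 hz) hpth
    have hfr : frattini M = R.ker := by
      rcases htri (frattini M) inferInstance with h | h | h
      · rw [h, le_bot_iff] at hle
        exact absurd hle hkerbot
      · exact h
      · exact absurd h frattini_ne_top
    rw [hfr]
    exact Nat.card_congr (QuotientGroup.quotientKerEquivOfSurjective R hRsurj).toEquiv

end Twist

section NaturalModule

variable {n : ℕ} {F : Type*} [Field F]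

@[simp] theorem natAct_apply (g : GL (Fin n) F) (v : Fin n → F) :
    natAct g v = Matrix.vecMul v (g : Matrix (Fin n) (Fin n) F) := rfl

theorem natAct_one (v : Fin n → F) : natAct (1 : GL (Fin n) F) v = v := by simp

theorem natAct_mul (g h : GL (Fin n) F) (v : Fin n → F) :
    natAct (g * h) v = natAct h (natAct g v) := by simp [Matrix.vecMul_vecMul]

theorem natAct_inv_natAct (g : GL (Fin n) F) (v : Fin n → F) :
    natAct g⁻¹ (natAct g v) = v := by
  rw [← natAct_mul, mul_inv_cancel, natAct_one]

theorem natAct_natAct_inv (g : GL (Fin n) F) (v : Fin n → F) :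
    natAct g (natAct g⁻¹ v) = v := by
  rw [← natAct_mul, inv_mul_cancel, natAct_one]

/-- The action of `g ∈ GL_n(F)` on row vectors as an additive automorphism. -/
def natActEquiv (g : GL (Fin n) F) : (Fin n → F) ≃+ (Fin n → F) where
  toFun := natAct g
  invFun := natAct g⁻¹
  left_inv := natAct_inv_natAct g
  right_inv := natAct_natAct_inv g
  map_add' := map_add (natAct g)

theorem exists_natAct_eq (σ : (Fin n → F) ≃ₗ[F] (Fin n → F)) :
    ∃ g : GL (Fin n) F, ∀ v, natAct g v = σ v := by
  refine ⟨⟨LinearMap.toMatrixRight' σ.toLinearMap, LinearMap.toMatrixRight' σ.symm.toLinearMap,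
    ?_, ?_⟩, fun v => ?_⟩
  · rw [← LinearMap.toMatrixRight'_comp, ← LinearMap.toMatrixRight'_id]
    congr 1
    ext; simp
  · rw [← LinearMap.toMatrixRight'_comp, ← LinearMap.toMatrixRight'_id]
    congr 1
    ext; simp
  · exact LinearMap.congr_fun (LinearMap.toMatrixRight'.symm_apply_apply σ.toLinearMap) v

theorem isIrred_of_forall_le {K : Subgroup (GL (Fin n) F)} (hK : IsIrred K)
    (S : Submodule F (Fin n → F)) (h : ∀ g ∈ K, ∀ v ∈ S, natAct g v ∈ S) : S = ⊥ ∨ S = ⊤ := by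
  refine hK S fun g hg => le_antisymm ?_ fun v hv => ?_
  · rintro _ ⟨v, hv, rfl⟩
    exact h g hg v hv
  · exact ⟨natAct g⁻¹ v, h _ (K.inv_mem hg) v hv, natAct_natAct_inv g v⟩

/-- An ESQ structure is the same as an invariant alternating product on the natural module whose
values span. -/
theorem isESQ_iff_exists_alternating (K : Subgroup (GL (Fin n) F)) :
    IsESQ K ↔ ∃ L : (Fin n → F) →ₗ[F] (Fin n → F) →ₗ[F] (Fin n → F),
      (∀ v, L v v = 0) ∧ Submodule.span F {x | ∃ u v, L u v = x} = ⊤ ∧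
      ∀ g ∈ K, ∀ u v, L (natAct g u) (natAct g v) = natAct g (L u v) := by
  constructor
  · rintro ⟨U, e, -, he⟩
    let q : (Fin n → F) ⊗[F] (Fin n → F) →ₗ[F] (Fin n → F) :=
      e.toLinearMap ∘ₗ U.mkQ ∘ₗ (sqSub F (Fin n → F)).mkQ
    refine ⟨(TensorProduct.mk F _ _).compr₂ q, fun v => ?_, ?_, fun g hg u v => ?_⟩
    · have : (sqSub F (Fin n → F)).mkQ (v ⊗ₜ[F] v) = 0 :=
        (Submodule.Quotient.mk_eq_zero _).2 (Submodule.subset_span ⟨v, rfl⟩)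
      change e (U.mkQ ((sqSub F (Fin n → F)).mkQ (v ⊗ₜ[F] v))) = 0
      rw [this, map_zero, map_zero]
    · have hq : Function.Surjective q :=
        e.surjective.comp ((Submodule.mkQ_surjective U).comp (Submodule.mkQ_surjective _))
      rw [← LinearMap.range_eq_top.2 hq, LinearMap.range_eq_map,
        ← TensorProduct.span_tmul_eq_top, Submodule.map_span]
      congr 1
      ext x
      constructor
      · rintro ⟨u, v, rfl⟩
        exact ⟨u ⊗ₜ v, ⟨u, v, rfl⟩, rfl⟩
      · rintro ⟨_, ⟨u, v, rfl⟩, rfl⟩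
        exact ⟨u, v, rfl⟩
    · exact he g hg (Submodule.Quotient.mk (u ⊗ₜ[F] v))
  · rintro ⟨L, halt, hspan, hL⟩
    have hle : sqSub F (Fin n → F) ≤ LinearMap.ker (TensorProduct.lift L) := by
      refine Submodule.span_le.2 ?_
      rintro _ ⟨v, rfl⟩
      change TensorProduct.lift L (v ⊗ₜ v) = 0
      rw [TensorProduct.lift.tmul, halt]
    let β : Wedge2 F (Fin n → F) →ₗ[F] (Fin n → F) := (sqSub F (Fin n → F)).liftQ _ hle
    have hβ : Function.Surjective β := by
      rw [← LinearMap.range_eq_top, eq_top_iff, ← hspan, Submodule.span_le]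
      rintro _ ⟨u, v, rfl⟩
      exact ⟨Submodule.Quotient.mk (u ⊗ₜ v), TensorProduct.lift.tmul u v⟩
    have heq : ∀ g ∈ K, ∀ w, β (wedge2Map (natAct g) w) = natAct g (β w) := by
      intro g hg w
      obtain ⟨t, rfl⟩ := Submodule.Quotient.mk_surjective _ w
      have : (TensorProduct.lift L) ∘ₗ TensorProduct.map (natAct g) (natAct g) =
          natAct g ∘ₗ TensorProduct.lift L :=
        TensorProduct.ext' fun u v => hL g hg u v
      exact LinearMap.congr_fun this t
    refine ⟨LinearMap.ker β, β.quotKerEquivOfSurjective hβ, fun g hg => ?_, fun g hg w => ?_⟩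
    · rintro _ ⟨w, hw, rfl⟩
      rw [LinearMap.mem_ker, heq g hg, LinearMap.mem_ker.1 hw, map_zero]
    · exact heq g hg w

/-- The subgroup of `GL_n(F)` preserving a bilinear product on the natural module. -/
def productStabilizer (L : (Fin n → F) →ₗ[F] (Fin n → F) →ₗ[F] (Fin n → F)) :
    Subgroup (GL (Fin n) F) where
  carrier := {g | ∀ u v, L (natAct g u) (natAct g v) = natAct g (L u v)}
  one_mem' u v := by simp only [natAct_one]
  mul_mem' {g h} hg hh u v := by rw [natAct_mul, natAct_mul, natAct_mul, hh, hg]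
  inv_mem' {g} hg u v := by
    have := hg (natAct g⁻¹ u) (natAct g⁻¹ v)
    rw [natAct_natAct_inv, natAct_natAct_inv] at this
    rw [this, natAct_inv_natAct]

end NaturalModule

section OfESQ

/-- Multiplication by `p` as an additive map `ZMod p → ZMod (p ^ 2)`. -/
def ZMod.mulSq (p : ℕ) : ZMod p →+ ZMod (p ^ 2) :=
  ZMod.lift p ⟨zmultiplesHom _ (p : ZMod (p ^ 2)), by
    have : ((p ^ 2 : ℕ) : ZMod (p ^ 2)) = 0 := ZMod.natCast_self _
    simpa [pow_two] using this⟩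

theorem ZMod.mulSq_intCast (p : ℕ) (k : ℤ) :
    ZMod.mulSq p (k : ZMod p) = (k * p : ZMod (p ^ 2)) := by
  simp [ZMod.mulSq]

theorem ZMod.mulSq_injective {p : ℕ} (hp : p ≠ 0) : Function.Injective (ZMod.mulSq p) := by
  rw [injective_iff_map_eq_zero]
  intro a ha
  obtain ⟨k, rfl⟩ := ZMod.intCast_surjective a
  rw [ZMod.mulSq_intCast] at ha
  have : ((k * p : ℤ) : ZMod (p ^ 2)) = 0 := by exact_mod_cast ha
  rw [ZMod.intCast_zmod_eq_zero_iff_dvd, Nat.cast_pow, pow_two] at this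
  exact (ZMod.intCast_zmod_eq_zero_iff_dvd _ _).2
    (Int.dvd_of_mul_dvd_mul_right (by exact_mod_cast hp) this)

/-- Reduction `ZMod (p ^ 2) → ZMod p`. -/
def ZMod.redSq (p : ℕ) : ZMod (p ^ 2) →+* ZMod p := ZMod.castHom (dvd_pow_self p two_ne_zero) _

theorem ZMod.redSq_surjective (p : ℕ) : Function.Surjective (ZMod.redSq p) :=
  ZMod.castHom_surjective _

theorem ZMod.mulSq_redSq (p : ℕ) (x : ZMod (p ^ 2)) : ZMod.mulSq p (ZMod.redSq p x) = p • x := by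
  obtain ⟨k, rfl⟩ := ZMod.intCast_surjective x
  rw [map_intCast, ZMod.mulSq_intCast, nsmul_eq_mul, mul_comm]

theorem ZMod.exists_mulSq_eq {p : ℕ} {x : ZMod (p ^ 2)} (hx : ZMod.redSq p x = 0) :
    ∃ a, ZMod.mulSq p a = x := by
  obtain ⟨k, rfl⟩ := ZMod.intCast_surjective x
  rw [map_intCast, ZMod.intCast_zmod_eq_zero_iff_dvd] at hx
  obtain ⟨m, rfl⟩ := hx
  exact ⟨m, by rw [ZMod.mulSq_intCast]; push_cast; ring⟩

theorem exists_ucs_of_isESQ {p : ℕ} [Fact p.Prime] (hodd : Odd p) {r : ℕ} (hr : 1 ≤ r)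
    {K : Subgroup (GL (Fin r) (ZMod p))} (hirr : IsIrred K) (hesq : IsESQ K) :
    ∃ (G : Type) (_ : Group G) (_ : Finite G),
      IsUCS p G ∧ (¬ ∀ a b : G, a * b = b * a) ∧
      Monoid.exponent G = p ^ 2 ∧ Nat.card (G ⧸ frattini G) = p ^ r := by
  obtain ⟨L, halt, hspan, hL⟩ := (isESQ_iff_exists_alternating K).1 hesq
  have hpr : p.Prime := Fact.out
  have : NeZero (p ^ 2) := ⟨pow_ne_zero _ hpr.ne_zero⟩
  have : Nonempty (Fin r) := ⟨⟨0, hr⟩⟩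
  have hL0 : ∃ u v, L u v ≠ 0 := by
    by_contra! h
    have : Submodule.span (ZMod p) {x | ∃ u v, L u v = x} ≤ ⊥ :=
      Submodule.span_le.2 (by rintro _ ⟨u, v, rfl⟩; exact h u v)
    rw [hspan] at this
    exact bot_ne_top (le_bot_iff.1 this).symm
  let red : (Fin r → ZMod (p ^ 2)) →+ (Fin r → ZMod p) := (ZMod.redSq p).toAddMonoidHom.compLeft _
  let B : (Fin r → ZMod p) →+ (Fin r → ZMod p) →+ (Fin r → ZMod p) :=
    AddMonoidHom.mk' (fun u => (L u).toAddMonoidHom) fun u v => by ext; simp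
  have key := exists_ucs_of_alternating hodd red ((ZMod.mulSq p).compLeft _) B
    (ZMod.redSq_surjective p).comp_left (ZMod.mulSq_injective hpr.ne_zero).comp_left
    (fun x => funext fun i => ZMod.mulSq_redSq p (x i))
    (fun x hx => by
      choose a ha using fun i => ZMod.exists_mulSq_eq (congr_fun hx i)
      exact ⟨a, funext ha⟩)
    (fun v => by ext i; simp) halt hL0
    (fun S hS => by
      have h := isIrred_of_forall_le hirr (AddSubgroup.toZModSubmodule p S) fun g hg v hv => ?_
      · simpa using h
      choose lift hlift using ZMod.redSq_surjective p
      refine hS (Matrix.vecMulLinear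
        ((g : Matrix (Fin r) (Fin r) (ZMod p)).map lift)).toAddMonoidHom
        (natActEquiv g) (fun x => ?_) (hL g hg) v hv
      ext i
      change ZMod.redSq p (Matrix.vecMul x _ i) = Matrix.vecMul (ZMod.redSq p ∘ x) _ i
      rw [RingHom.map_vecMul, Matrix.map_map, show ZMod.redSq p ∘ lift = id from funext hlift,
        Matrix.map_id])
  obtain ⟨inst, h1, h2, h3, h4⟩ := key
  exact ⟨_, inst, inferInstance, h1, h2, h3, by rw [h4]; simp⟩

end OfESQ

section ToESQ

open Subgroup
open scoped commutatorElement

theorem mul_pow_of_mul_eq_mul_mul {G : Type*} [Group G] {x y c : G} (hc : c ∈ center G)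
    (h : y * x = x * y * c) (n : ℕ) : (x * y) ^ n = x ^ n * y ^ n * c ^ n.choose 2 := by
  have hcomm : ∀ (m : ℕ) (g : G), g * c ^ m = c ^ m * g := fun m =>
    mem_center_iff.1 (pow_mem hc m)
  have hyx : ∀ m : ℕ, y ^ m * x = x * y ^ m * c ^ m := by
    intro m
    induction m with
    | zero => simp
    | succ m ih =>
      calc y ^ (m + 1) * x = y * (y ^ m * x) := by rw [pow_succ', mul_assoc]
        _ = (y * x) * y ^ m * c ^ m := by rw [ih]; group
        _ = x * y * (c ^ 1 * y ^ m) * c ^ m := by rw [h, pow_one]; group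
        _ = x * y ^ (m + 1) * c ^ (m + 1) := by rw [← hcomm]; group
  induction n with
  | zero => simp
  | succ n ih =>
    calc (x * y) ^ (n + 1) = x ^ n * y ^ n * (c ^ n.choose 2 * (x * y)) := by
          rw [pow_succ, ih, mul_assoc]
      _ = x ^ n * (y ^ n * x) * y * c ^ n.choose 2 := by rw [← hcomm]; group
      _ = x ^ n * x * y ^ n * (c ^ n * y) * c ^ n.choose 2 := by rw [hyx]; group
      _ = x ^ (n + 1) * y ^ (n + 1) * c ^ (n + 1).choose 2 := by
          rw [← hcomm, Nat.choose_succ_succ' n 1, Nat.choose_one_right, pow_add, pow_succ, pow_succ]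
          group

/-- In a group of class two, taking commutators is multiplicative in the first variable. -/
theorem commutatorElement_mul_left_of_le_center {G : Type*} [Group G]
    (h : commutator G ≤ center G) (x y z : G) : ⁅x * y, z⁆ = ⁅x, z⁆ * ⁅y, z⁆ := by
  have h1 := mem_center_iff.1 (h (commutator_mem_commutator (mem_top y) (mem_top z)))
  calc ⁅x * y, z⁆ = x * ⁅y, z⁆ * x⁻¹ * ⁅x, z⁆ := by simp only [commutatorElement_def]; group
    _ = ⁅y, z⁆ * ⁅x, z⁆ := by rw [h1 x, mul_inv_cancel_right]
    _ = ⁅x, z⁆ * ⁅y, z⁆ := (h1 _).symm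

/-- In a group of class two, taking commutators is multiplicative in the second variable. -/
theorem commutatorElement_mul_right_of_le_center {G : Type*} [Group G]
    (h : commutator G ≤ center G) (x y z : G) : ⁅x, y * z⁆ = ⁅x, y⁆ * ⁅x, z⁆ := by
  have h1 := mem_center_iff.1 (h (commutator_mem_commutator (mem_top x) (mem_top z)))
  calc ⁅x, y * z⁆ = ⁅x, y⁆ * (y * ⁅x, z⁆ * y⁻¹) := by simp only [commutatorElement_def]; group
    _ = ⁅x, y⁆ * ⁅x, z⁆ := by rw [h1 y, mul_inv_cancel_right]

/-- The structure of a non-abelian UCS `p`-group of exponent `p ^ 2`: the centre, the commutator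
subgroup and the Frattini subgroup agree, and the `p`-th power map is an endomorphism whose kernel
and range are both equal to that subgroup. -/
theorem IsUCS.center_eq_and_pow {p : ℕ} [Fact p.Prime] (hodd : Odd p) {G : Type*} [Group G] [Finite G]
    (hG : IsUCS p G) (hna : ¬ ∀ a b : G, a * b = b * a) (hexp : Monoid.exponent G = p ^ 2) :
    commutator G = center G ∧ (∀ z ∈ center G, z ^ p = 1) ∧ frattini G = center G ∧
      (∀ H : Subgroup G, H.Characteristic → H = ⊥ ∨ H = center G ∨ H = ⊤) ∧
      ∃ P : G →* G, (∀ x, P x = x ^ p) ∧ P.ker = center G ∧ P.range = center G := by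
  obtain ⟨hpG, hcard⟩ := hG
  have hpr : p.Prime := Fact.out
  have hntriv : Nontrivial G := by
    by_contra h
    rw [not_nontrivial_iff_subsingleton] at h
    exact hna fun a b => Subsingleton.elim _ _
  have hZtop : center G ≠ ⊤ := fun h => hna fun a b =>
    (mem_center_iff.1 (h ▸ mem_top a : a ∈ center G) b).symm
  have hZnt : Nontrivial (center G) := hpG.center_nontrivial
  have hZbot : center G ≠ ⊥ := (nontrivial_iff_ne_bot _).1 hZnt
  have htri := characteristic_trichotomy hcard inferInstance hZbot hZtop
  have hnil : Group.IsNilpotent G := hpG.isNilpotent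
  have hcomm : commutator G = center G := by
    rcases htri (commutator G) inferInstance with h | h | h
    · rw [commutator_eq_bot_iff_center_eq_top] at h
      exact absurd h hZtop
    · exact h
    · exact absurd h (Group.IsSolvable.commutator_lt_top_of_nontrivial G).ne
  have hZp : ∀ z ∈ center G, z ^ p = 1 := by
    let H : Subgroup G :=
      { carrier := {z | z ∈ center G ∧ z ^ p = 1}
        one_mem' := ⟨one_mem _, one_pow p⟩
        mul_mem' := fun {a b} ha hb => ⟨mul_mem ha.1 hb.1, by
          have hc : Commute a b := mem_center_iff.1 hb.1 a
          rw [hc.mul_pow, ha.2, hb.2, mul_one]⟩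
        inv_mem' := fun {a} ha => ⟨inv_mem ha.1, by rw [inv_pow, ha.2, inv_one]⟩ }
    have hH : H.Characteristic := characteristic_iff_le_comap.2 fun φ x hx =>
      ⟨characteristic_iff_le_comap.1 inferInstance φ hx.1, by
        change φ x ^ p = 1
        rw [← map_pow, hx.2, map_one]⟩
    have hHZ : H ≤ center G := fun x hx => hx.1
    rcases htri H hH with h | h | h
    · have hdvd : p ∣ Nat.card (center G) :=
        (hpG.to_subgroup _).card_eq_or_dvd.resolve_left Finite.one_lt_card.ne'
      obtain ⟨z, hz⟩ := exists_prime_orderOf_dvd_card' p hdvd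
      have hzH : (z : G) ∈ H := ⟨z.2, by
        rw [← SubmonoidClass.coe_pow, ← hz, pow_orderOf_eq_one, OneMemClass.coe_one]⟩
      rw [h, mem_bot, OneMemClass.coe_eq_one] at hzH
      rw [hzH, orderOf_one] at hz
      exact absurd hz.symm hpr.ne_one
    · intro z hz
      exact (h ▸ hz : z ∈ H).2
    · exact absurd (top_le_iff.1 (h ▸ hHZ)) hZtop
  let P : G →* G :=
    { toFun := fun x => x ^ p
      map_one' := one_pow p
      map_mul' := fun x y => by
        have hc : ⁅y⁻¹, x⁻¹⁆ ∈ center G :=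
          hcomm ▸ commutator_mem_commutator (mem_top _) (mem_top _)
        obtain ⟨k, hk⟩ : p ∣ p.choose 2 := hpr.dvd_choose_self two_ne_zero
          (lt_of_le_of_ne hpr.two_le (by rintro rfl; exact absurd hodd (by decide)))
        rw [mul_pow_of_mul_eq_mul_mul hc (by simp only [commutatorElement_def]; group) p, hk,
          pow_mul, hZp _ hc, one_pow, mul_one] }
  have hPchar : ∀ (α : G ≃* G) (x : G), P (α x) = α (P x) := fun α x => (map_pow α x p).symm
  have hker : P.ker = center G := by
    have hle : center G ≤ P.ker := hZp
    rcases htri P.ker (characteristic_iff_le_comap.2 fun α x hx => by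
      change P (α x) = 1
      rw [hPchar, MonoidHom.mem_ker.1 hx, map_one]) with h | h | h
    · exact absurd (le_bot_iff.1 (h ▸ hle)) hZbot
    · exact h
    · have : Monoid.exponent G ∣ p := Monoid.exponent_dvd_of_forall_pow_eq_one fun x =>
        (h ▸ mem_top x : x ∈ P.ker)
      rw [hexp, pow_two] at this
      have h1 := Nat.le_of_dvd hpr.pos this
      have h2 := hpr.two_le
      nlinarith
  have hrange : P.range = center G := by
    rcases htri P.range (characteristic_iff_le_comap.2 fun α x hx => by
      obtain ⟨y, rfl⟩ := hx
      exact ⟨α y, hPchar α y⟩) with h | h | h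
    · rw [MonoidHom.range_eq_bot_iff] at h
      rw [h, MonoidHom.ker_one] at hker
      exact absurd hker.symm hZtop
    · exact h
    · rw [MonoidHom.range_eq_top, ← Finite.injective_iff_surjective, ← MonoidHom.ker_eq_bot_iff,
        hker] at h
      exact absurd h hZbot
  refine ⟨hcomm, hZp, ?_, htri, P, fun _ => rfl, hker, hrange⟩
  have hle : center G ≤ frattini G := le_frattini_of_pow le_rfl hZp fun z hz => by
    rw [← hrange] at hz
    exact hz
  rcases htri (frattini G) inferInstance with h | h | h
  · exact absurd (le_bot_iff.1 (h ▸ hle)) hZbot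
  · exact h
  · exact absurd h frattini_ne_top

theorem nonempty_addEquiv_of_card_eq_pow {p : ℕ} [Fact p.Prime] {r : ℕ} {A : Type*}
    [AddCommGroup A] [Module (ZMod p) A] (hcard : Nat.card A = p ^ r) :
    Nonempty (A ≃+ (Fin r → ZMod p)) := by
  have hpr : p.Prime := Fact.out
  have : Finite A := Nat.finite_of_card_ne_zero (hcard ▸ pow_ne_zero _ hpr.ne_zero)
  have hfin : Module.finrank (ZMod p) A = r := by
    have h := Module.natCard_eq_pow_finrank (K := ZMod p) (V := A)
    rw [hcard, Nat.card_zmod] at h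
    exact (Nat.pow_right_injective hpr.two_le h).symm
  obtain ⟨e⟩ : Nonempty (A ≃ₗ[ZMod p] (Fin r → ZMod p)) :=
    FiniteDimensional.nonempty_linearEquiv_of_finrank_eq (by rw [hfin]; simp)
  exact ⟨e.toAddEquiv⟩

theorem nonempty_additive_addEquiv_of_pow_eq_one {p : ℕ} [Fact p.Prime] {r : ℕ} {Z : Type*}
    [Group Z] (hcomm : ∀ z w : Z, z * w = w * z) (hp : ∀ z : Z, z ^ p = 1)
    (hcard : Nat.card Z = p ^ r) : Nonempty (Additive Z ≃+ (Fin r → ZMod p)) := by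
  let _ : CommGroup Z := { mul_comm := hcomm }
  let _ : Module (ZMod p) (Additive Z) := AddCommGroup.zmodModule hp
  exact nonempty_addEquiv_of_card_eq_pow hcard

theorem exists_isESQ_of_ucs {p : ℕ} [Fact p.Prime] (hodd : Odd p) {r : ℕ}
    {G : Type*} [Group G] [Finite G] (hG : IsUCS p G) (hna : ¬ ∀ a b : G, a * b = b * a)
    (hexp : Monoid.exponent G = p ^ 2) (hcard : Nat.card (G ⧸ frattini G) = p ^ r) :
    ∃ K : Subgroup (GL (Fin r) (ZMod p)), IsIrred K ∧ IsESQ K := by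
  obtain ⟨hcomm, hZp, hfr, htri, P, hP, hker, hrange⟩ := hG.center_eq_and_pow hodd hna hexp
  have hpr : p.Prime := Fact.out
  have hcardZ : Nat.card (center G) = p ^ r := by
    have h := Nat.card_congr (QuotientGroup.quotientKerEquivRange P).toEquiv
    rw [hrange, hker, ← hfr, hcard, hfr] at h
    exact h.symm
  obtain ⟨ι⟩ := nonempty_additive_addEquiv_of_pow_eq_one
    (fun z w => Subtype.ext (mem_center_iff.1 w.2 z)) (fun z => Subtype.ext (hZp z z.2)) hcardZ
  have hcl := commutatorElement_mul_left_of_le_center hcomm.le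
  have hcr := commutatorElement_mul_right_of_le_center hcomm.le
  -- commutators, viewed in the natural module
  let c : G → G → (Fin r → ZMod p) := fun x y => ι (Additive.ofMul
    ⟨⁅x, y⁆, hcomm.le (commutator_mem_commutator (mem_top x) (mem_top y))⟩)
  have hcl' : ∀ x y z, c (x * y) z = c x z + c y z := fun x y z => by
    rw [← map_add, ← ofMul_mul]
    exact congrArg (fun t => ι (Additive.ofMul t)) (Subtype.ext (hcl x y z))
  have hcr' : ∀ x y z, c x (y * z) = c x y + c x z := fun x y z => by
    rw [← map_add, ← ofMul_mul]
    exact congrArg (fun t => ι (Additive.ofMul t)) (Subtype.ext (hcr x y z))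
  have hc0 : ∀ x y, c x y = 0 ↔ ⁅x, y⁆ = 1 := fun x y => by
    rw [map_eq_zero_iff ι ι.injective, ofMul_eq_zero, Subtype.ext_iff, OneMemClass.coe_one]
  -- the projection onto the natural module given by the power map
  let Q : G → (Fin r → ZMod p) := fun g => ι (Additive.ofMul ⟨P g, hrange.le ⟨g, rfl⟩⟩)
  have hQmul : ∀ x y, Q (x * y) = Q x + Q y := fun x y => by
    rw [← map_add, ← ofMul_mul]
    exact congrArg (fun t => ι (Additive.ofMul t)) (Subtype.ext (map_mul P x y))
  have hQ0 : ∀ x, Q x = 0 ↔ x ∈ center G := fun x => by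
    rw [map_eq_zero_iff ι ι.injective, ofMul_eq_zero, Subtype.ext_iff, OneMemClass.coe_one]
    exact MonoidHom.mem_ker.symm.trans (SetLike.ext_iff.1 hker x)
  have hQsurj : Function.Surjective Q := by
    intro w
    obtain ⟨z, rfl⟩ := ι.surjective w
    obtain ⟨g, hg⟩ : (z.toMul : G) ∈ P.range := hrange.ge z.toMul.2
    exact ⟨g, congrArg ι (Additive.toMul.injective (Subtype.ext hg))⟩
  have hQeq : ∀ x y, Q x = Q y → ∃ z ∈ center G, y = x * z := fun x y h => by
    refine ⟨x⁻¹ * y, (hQ0 _).1 ?_, (mul_inv_cancel_left x y).symm⟩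
    have := hQmul x (x⁻¹ * y)
    rwa [mul_inv_cancel_left, h, left_eq_add] at this
  have hcQ : ∀ x x' y y', Q x = Q x' → Q y = Q y' → c x y = c x' y' := by
    intro x x' y y' hx hy
    obtain ⟨z, hz, rfl⟩ := hQeq x x' hx
    obtain ⟨t, ht, rfl⟩ := hQeq y y' hy
    have h1 : ∀ g, c z g = 0 := fun g => by
      rw [hc0, commutatorElement_eq_one_iff_mul_comm, mem_center_iff.1 hz]
    have h2 : ∀ g, c g t = 0 := fun g => by
      rw [hc0, commutatorElement_eq_one_iff_mul_comm, mem_center_iff.1 ht]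
    rw [hcl', hcr', h1, h2, add_zero, add_zero]
  choose s hs using hQsurj
  have hadd_left : ∀ u v w, c (s (u + v)) (s w) = c (s u) (s w) + c (s v) (s w) := fun u v w => by
    rw [← hcl']
    exact hcQ _ _ _ _ (by rw [hQmul, hs, hs, hs]) rfl
  have hadd_right : ∀ u v w, c (s u) (s (v + w)) = c (s u) (s v) + c (s u) (s w) := fun u v w => by
    rw [← hcr']
    exact hcQ _ _ _ _ rfl (by rw [hQmul, hs, hs, hs])
  let L : (Fin r → ZMod p) →ₗ[ZMod p] (Fin r → ZMod p) →ₗ[ZMod p] (Fin r → ZMod p) :=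
    LinearMap.mk₂ (ZMod p) (fun u v => c (s u) (s v)) hadd_left
      (fun a u w => ZMod.map_smul
        (AddMonoidHom.mk' (fun u => c (s u) (s w)) fun u v => hadd_left u v w) a u)
      hadd_right
      (fun a u w => ZMod.map_smul
        (AddMonoidHom.mk' (fun w => c (s u) (s w)) (hadd_right u)) a w)
  have hLQ : ∀ x y, L (Q x) (Q y) = c x y := fun x y => hcQ _ _ _ _ (hs _) (hs _)
  have hirr : ∀ S : Submodule (ZMod p) (Fin r → ZMod p),
      (∀ g ∈ productStabilizer L, ∀ v ∈ S, natAct g v ∈ S) → S = ⊥ ∨ S = ⊤ := by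
    intro S hS
    let H : Subgroup G :=
      { carrier := {g | Q g ∈ S}
        one_mem' := by
          change Q 1 ∈ S
          rw [(hQ0 1).2 (one_mem _)]
          exact zero_mem S
        mul_mem' := fun {a b} ha hb => by
          change Q (a * b) ∈ S
          rw [hQmul]
          exact add_mem ha hb
        inv_mem' := fun {a} ha => by
          change Q a⁻¹ ∈ S
          have h := hQmul a⁻¹ a
          rw [inv_mul_cancel, (hQ0 1).2 (one_mem _), eq_comm, add_eq_zero_iff_eq_neg] at h
          rw [h]
          exact neg_mem ha }
    have hZH : center G ≤ H := fun z hz => by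
      change Q z ∈ S
      rw [(hQ0 z).2 hz]
      exact zero_mem S
    have hH : H.Characteristic := by
      refine characteristic_iff_le_comap.2 fun α x hx => ?_
      let τ : Additive (center G) ≃+ Additive (center G) :=
        MulEquiv.toAdditive (MulAut.characteristic (center G) α)
      let σ : (Fin r → ZMod p) ≃ₗ[ZMod p] (Fin r → ZMod p) :=
        (ι.symm.trans (τ.trans ι)).toLinearEquiv (ZMod.map_smul (ι.symm.trans (τ.trans ι)))
      have hσι : ∀ z, σ (ι z) = ι (τ z) := fun z =>
        congrArg (fun t => ι (τ t)) (ι.symm_apply_apply z)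
      have hσQ : ∀ x, σ (Q x) = Q (α x) := fun x => by
        rw [hσι]
        refine congrArg ι (Additive.toMul.injective (Subtype.ext ?_))
        change α (P x) = P (α x)
        rw [hP, hP, map_pow]
      have hσc : ∀ x y, σ (c x y) = c (α x) (α y) := fun x y => by
        rw [hσι]
        refine congrArg ι (Additive.toMul.injective (Subtype.ext ?_))
        exact map_commutatorElement α x y
      obtain ⟨g, hg⟩ := exists_natAct_eq σ
      have hgL : g ∈ productStabilizer L := by
        intro u v
        rw [hg, hg, hg, ← hs u, ← hs v, hσQ, hσQ, hLQ, hLQ, hσc]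
      change Q (α x) ∈ S
      rw [← hσQ, ← hg]
      exact hS g hgL _ hx
    rcases htri H hH with h | h | h
    · rw [h, le_bot_iff] at hZH
      rw [hZH, commutator_eq_bot_iff_center_eq_top] at hcomm
      refine absurd (fun a b => ?_) hna
      exact (mem_center_iff.1 (hcomm ▸ mem_top a : a ∈ center G) b).symm
    · left
      rw [Submodule.eq_bot_iff]
      intro v hv
      have : s v ∈ H := by
        change Q (s v) ∈ S
        rwa [hs]
      rw [h, ← hQ0, hs] at this
      exact this
    · right
      rw [eq_top_iff]
      intro v _
      rw [← hs v]
      exact (h ▸ mem_top (s v) : s v ∈ H)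
  refine ⟨productStabilizer L, fun S hS => hirr S fun g hg v hv => ?_,
    (isESQ_iff_exists_alternating _).2 ⟨L, fun v => ?_, ?_, fun g hg => hg⟩⟩
  · rw [← hS g hg]
    exact ⟨v, hv, rfl⟩
  · exact (hc0 _ _).2 (commutatorElement_self _)
  · refine (hirr _ fun g hg v hv => ?_).resolve_left fun h => hna fun a b => ?_
    · have hle : Submodule.span (ZMod p) {x | ∃ u v, L u v = x} ≤
          (Submodule.span (ZMod p) {x | ∃ u v, L u v = x}).comap (natAct g) := by
        refine Submodule.span_le.2 ?_
        rintro _ ⟨u, v, rfl⟩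
        exact Submodule.subset_span ⟨_, _, hg u v⟩
      exact hle hv
    · rw [← commutatorElement_eq_one_iff_mul_comm, ← hc0, ← hLQ]
      have : L (Q a) (Q b) ∈ Submodule.span (ZMod p) {x | ∃ u v, L u v = x} :=
        Submodule.subset_span ⟨_, _, rfl⟩
      rwa [h, Submodule.mem_bot] at this

end ToESQ

theorem stmt10 (p : ℕ) [Fact p.Prime] (hodd : Odd p) (r : ℕ) (hr : 1 ≤ r) :
    (∃ (G : Type) (_ : Group G) (_ : Finite G),
        IsUCS p G ∧ (¬ ∀ a b : G, a * b = b * a) ∧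
        Monoid.exponent G = p ^ 2 ∧
        Nat.card (G ⧸ frattini G) = p ^ r) ↔
      -- there is an irreducible subgroup `K ≤ GL_r(F_p)` and a `K`-submodule
      -- `U ≤ Λ²(F_p^r)` with `Λ²(F_p^r)/U` isomorphic to the natural module
      (∃ K : Subgroup (GL (Fin r) (ZMod p)), IsIrred K ∧ IsESQ K) := by
  constructor
  · rintro ⟨G, _, _, hG, hna, hexp, hcard⟩
    exact exists_isESQ_of_ucs hodd hG hna hexp hcard
  · rintro ⟨K, hirr, hesq⟩
    exact exists_ucs_of_isESQ hodd hr hirr hesq
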